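/- arXiv:2111.10397 — 2 statements merged into one kernel-verified Lean document; each statement's English description precedes it below -/
import Mathlib

section
/- Let f : ℝ×ℝ → ℂ be measurable, 2π-periodic in its first variable, even, and square-integrable, i.e. ∫₀^{2π} ∫_{−∞}^{∞} |f(s,t)|² dt ds < ∞. Then ∫₀^{2π} ∫₀^{π/2} ( (1/(2π)) ∫₀^{2π} |f(s, −tan ρ · cos(θ−s))| ds )² · sin ρ dρ dθ ≤ ∫₀^{2π} ∫_{−∞}^{∞} |f(s,t)|² dt ds. In particular Rf(θ,ρ) is defined by an absolutely convergent integral for almost every (θ,ρ) ∈ [0,2π)×[0,π/2), and 2·∫₀^{2π} ∫₀^{π/2} |Rf(θ,ρ)|² sin ρ dρ dθ ≤ 2·∫₀^{2π} ∫_{−∞}^{∞} |f(s,t)|² dt ds (continuity of R with norm bound √2). -/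
open MeasureTheory Real Filter Set Topology ENNReal NNReal

/-- Parametric Radon transform on the cylinder:
`Rf(θ,ρ) = (1/(2π)) ∫₀^{2π} f(s, −tan ρ · cos(θ−s)) ds`. -/
noncomputable def RT (f : ℝ → ℝ → ℂ) (θ ρ : ℝ) : ℂ :=
  (1 / (2 * π)) * ∫ s in (0:ℝ)..(2 * π), f s (-Real.tan ρ * Real.cos (θ - s))

/-- `n`-th Fourier coefficient of a function on the cylinder (in the angular variable). -/
noncomputable def Fc (f : ℝ → ℝ → ℂ) (n : ℤ) (t : ℝ) : ℂ :=
  (1 / (2 * π)) * ∫ s in (0:ℝ)..(2 * π), f s t * Complex.exp (-Complex.I * n * s)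

/-- `n`-th Fourier coefficient of `Rf` (in the variable θ). -/
noncomputable def Gc (f : ℝ → ℝ → ℂ) (n : ℤ) (ρ : ℝ) : ℂ :=
  (1 / (2 * π)) * ∫ θ in (0:ℝ)..(2 * π), RT f θ ρ * Complex.exp (-Complex.I * n * θ)

/-- The kernel that appears when the variable `ρ` is replaced by `t = -tan ρ * c`. -/
noncomputable def radonKernel (t c : ℝ) : ℝ :=
  |t| * |c| / ((c ^ 2 + t ^ 2) * √(c ^ 2 + t ^ 2))

lemma radonKernel_nonneg (t c : ℝ) : 0 ≤ radonKernel t c := by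
  unfold radonKernel; positivity

lemma measurable_radonKernel : Measurable fun p : ℝ × ℝ => radonKernel p.1 p.2 := by
  unfold radonKernel; fun_prop

lemma continuous_radonKernel_cos {t : ℝ} (ht : t ≠ 0) :
    Continuous fun u : ℝ => radonKernel t (cos u) := by
  unfold radonKernel
  refine Continuous.div (by fun_prop) (by fun_prop) fun u => ?_
  positivity

lemma hasDerivAt_radonKernel_primitive {t : ℝ} (ht : t ≠ 0) (u : ℝ) :
    HasDerivAt (fun u : ℝ => |t| * sin u / ((1 + t ^ 2) * √(cos u ^ 2 + t ^ 2)))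
      (|t| * cos u / ((cos u ^ 2 + t ^ 2) * √(cos u ^ 2 + t ^ 2))) u := by
  have hw : 0 < cos u ^ 2 + t ^ 2 := by positivity
  have hr : 0 < √(cos u ^ 2 + t ^ 2) := sqrt_pos.2 hw
  have hsq : √(cos u ^ 2 + t ^ 2) ^ 2 = cos u ^ 2 + t ^ 2 := sq_sqrt hw.le
  have h1 : HasDerivAt (fun u : ℝ => cos u ^ 2 + t ^ 2) (2 * cos u * (-sin u)) u := by
    simpa using ((hasDerivAt_cos u).pow 2).add_const (t ^ 2)
  have h2 := ((hasDerivAt_sin u).const_mul |t|).div ((h1.sqrt hw.ne').const_mul (1 + t ^ 2))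
    (by positivity)
  refine h2.congr_deriv ?_
  have hs : sin u ^ 2 = 1 - cos u ^ 2 := sin_sq u
  set r := √(cos u ^ 2 + t ^ 2)
  rw [← hsq]
  field_simp
  linear_combination cos u * (hsq + hs)

lemma integral_radonKernel_cos {t : ℝ} (ht : t ≠ 0) (s : ℝ) :
    ∫ θ in (0 : ℝ)..2 * π, radonKernel t (cos (θ - s)) = 4 / (1 + t ^ 2) := by
  have hcont := continuous_radonKernel_cos ht
  have hint (a b : ℝ) := hcont.intervalIntegrable (μ := volume) a b
  have hsigned : Continuous fun u : ℝ =>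
      |t| * cos u / ((cos u ^ 2 + t ^ 2) * √(cos u ^ 2 + t ^ 2)) :=
    Continuous.div (by fun_prop) (by fun_prop) fun u => by positivity
  have hftc (a b : ℝ) := intervalIntegral.integral_eq_sub_of_hasDerivAt
    (fun u _ => hasDerivAt_radonKernel_primitive ht u) (hsigned.intervalIntegrable a b)
  have hperiodic : Function.Periodic (fun u : ℝ => radonKernel t (cos u)) (2 * π) := fun u => by
    simp [cos_add_two_pi]
  have hpos := hftc (-(π / 2)) (π / 2)
  have hneg := hftc (π / 2) (-(π / 2) + 2 * π)
  have hpi := Real.pi_pos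
  have e1 : ∫ u in -(π / 2)..π / 2, radonKernel t (cos u) = 2 / (1 + t ^ 2) := by
    rw [intervalIntegral.integral_congr
      (g := fun u => |t| * cos u / ((cos u ^ 2 + t ^ 2) * √(cos u ^ 2 + t ^ 2))), hpos]
    · simp [sqrt_sq_eq_abs]
      field_simp
      norm_num
    · intro u hu
      rw [uIcc_of_le (by linarith)] at hu
      simp only [radonKernel, abs_of_nonneg (cos_nonneg_of_mem_Icc hu)]
  have e2 : ∫ u in π / 2..-(π / 2) + 2 * π, radonKernel t (cos u) = 2 / (1 + t ^ 2) := by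
    rw [intervalIntegral.integral_congr
      (g := fun u => -(|t| * cos u / ((cos u ^ 2 + t ^ 2) * √(cos u ^ 2 + t ^ 2)))),
      intervalIntegral.integral_neg, hneg]
    · rw [sin_add_two_pi, cos_add_two_pi]
      simp [sqrt_sq_eq_abs]
      field_simp
      norm_num
    · intro u hu
      rw [uIcc_of_le (by linarith)] at hu
      have := cos_nonpos_of_pi_div_two_le_of_le hu.1 (by linarith [hu.2])
      simp only [radonKernel, abs_of_nonpos this]
      ring
  rw [intervalIntegral.integral_comp_sub_right (fun u => radonKernel t (cos u)) s,
    show 2 * π - s = (0 - s) + 2 * π by ring,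
    hperiodic.intervalIntegral_add_eq (0 - s) (-(π / 2)),
    ← intervalIntegral.integral_add_adjacent_intervals (hint _ (π / 2)) (hint _ _), e1, e2]
  ring

lemma lintegral_radonKernel_cos_le (t s : ℝ) :
    ∫⁻ θ in Ioc 0 (2 * π), ENNReal.ofReal (radonKernel t (cos (θ - s)))
      ≤ ENNReal.ofReal (2 * π) := by
  rcases eq_or_ne t 0 with rfl | ht
  · simp [radonKernel]
  have hcont : Continuous fun θ : ℝ => radonKernel t (cos (θ - s)) :=
    (continuous_radonKernel_cos ht).comp (continuous_id.sub continuous_const)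
  rw [← ofReal_integral_eq_lintegral_ofReal
      (intervalIntegrable_iff_integrableOn_Ioc_of_le two_pi_pos.le |>.1
        (hcont.intervalIntegrable _ _))
      (ae_of_all _ fun _ => radonKernel_nonneg _ _),
    ← intervalIntegral.integral_of_le two_pi_pos.le, integral_radonKernel_cos ht]
  refine ENNReal.ofReal_le_ofReal ?_
  have : 4 / (1 + t ^ 2) ≤ 4 := div_le_self (by norm_num) (by nlinarith)
  linarith [pi_gt_three]

lemma ofReal_sin_eq_deriv_mul_radonKernel {ρ c : ℝ} (hρ : ρ ∈ Ioo 0 (π / 2)) (hc : c ≠ 0) :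
    |-(1 / cos ρ ^ 2) * c| * radonKernel (-tan ρ * c) c = sin ρ := by
  have hcos : 0 < cos ρ := cos_pos_of_mem_Ioo ⟨by linarith [hρ.1, Real.pi_pos], hρ.2⟩
  have htan : 0 < tan ρ := tan_pos_of_pos_of_lt_pi_div_two hρ.1 hρ.2
  have hw : c ^ 2 + (-tan ρ * c) ^ 2 = (|c| / cos ρ) ^ 2 := by
    rw [div_pow, sq_abs, neg_mul, neg_sq, tan_eq_sin_div_cos]
    field_simp
    linear_combination cos_sq_add_sin_sq ρ
  have hc' : 0 < |c| := abs_pos.2 hc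
  rw [radonKernel, hw, Real.sqrt_sq (by positivity), abs_mul, abs_mul, abs_neg, abs_neg,
    abs_of_pos htan, abs_of_pos (show 0 < 1 / cos ρ ^ 2 by positivity), tan_eq_sin_div_cos]
  field_simp

lemma lintegral_comp_tan_mul_le (h : ℝ → ℝ≥0∞) {c : ℝ} (hc : c ≠ 0) :
    ∫⁻ ρ in Ioc 0 (π / 2), h (-tan ρ * c) * ENNReal.ofReal (sin ρ)
      ≤ ∫⁻ t, h t * ENNReal.ofReal (radonKernel t c) := by
  have hderiv : ∀ ρ ∈ Ioo 0 (π / 2),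
      HasDerivWithinAt (fun ρ => -tan ρ * c) (-(1 / cos ρ ^ 2) * c) (Ioo 0 (π / 2)) ρ := by
    intro ρ hρ
    have hcos : 0 < cos ρ := cos_pos_of_mem_Ioo ⟨by linarith [hρ.1, Real.pi_pos], hρ.2⟩
    exact ((hasDerivAt_tan hcos.ne').neg.mul_const c).hasDerivWithinAt
  have hinj : InjOn (fun ρ => -tan ρ * c) (Ioo 0 (π / 2)) := by
    intro x hx y hy hxy
    have hsub : Ioo 0 (π / 2) ⊆ Ioo (-(π / 2)) (π / 2) :=
      Ioo_subset_Ioo_left (by linarith [Real.pi_pos])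
    exact injOn_tan (hsub hx) (hsub hy) (neg_injective (mul_right_cancel₀ hc hxy))
  calc ∫⁻ ρ in Ioc 0 (π / 2), h (-tan ρ * c) * ENNReal.ofReal (sin ρ)
      = ∫⁻ ρ in Ioo 0 (π / 2), h (-tan ρ * c) * ENNReal.ofReal (sin ρ) :=
        setLIntegral_congr Ioo_ae_eq_Ioc.symm
    _ = ∫⁻ ρ in Ioo 0 (π / 2), ENNReal.ofReal |-(1 / cos ρ ^ 2) * c| *
          (h (-tan ρ * c) * ENNReal.ofReal (radonKernel (-tan ρ * c) c)) := by
        refine setLIntegral_congr_fun measurableSet_Ioo fun ρ hρ => ?_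
        rw [mul_left_comm, ← ENNReal.ofReal_mul (abs_nonneg _),
          ofReal_sin_eq_deriv_mul_radonKernel hρ hc]
    _ = ∫⁻ t in (fun ρ => -tan ρ * c) '' Ioo 0 (π / 2),
          h t * ENNReal.ofReal (radonKernel t c) :=
        (lintegral_image_eq_lintegral_abs_deriv_mul measurableSet_Ioo hderiv hinj
          fun t => h t * ENNReal.ofReal (radonKernel t c)).symm
    _ ≤ _ := setLIntegral_le_lintegral _ _

lemma ae_cos_sub_ne_zero (s : ℝ) : ∀ᵐ θ : ℝ, cos (θ - s) ≠ 0 := by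
  have hsub : {θ : ℝ | ¬ cos (θ - s) ≠ 0} ⊆ range fun k : ℤ => (2 * k + 1) * π / 2 + s := by
    intro θ hθ
    obtain ⟨k, hk⟩ := cos_eq_zero_iff.1 (not_not.1 hθ)
    exact ⟨k, by simp only; linarith⟩
  exact ((countable_range _).mono hsub).measure_zero _

lemma measurable_comp_tan_mul_cos {h : ℝ → ℝ≥0∞} (hh : Measurable h) (s : ℝ) :
    Measurable fun p : ℝ × ℝ =>
      h p.2 * ENNReal.ofReal (radonKernel p.2 (cos (p.1 - s))) :=
  (hh.comp measurable_snd).mul <| ENNReal.measurable_ofReal.comp <|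
    measurable_radonKernel.comp (measurable_snd.prodMk (by fun_prop))

lemma lintegral_lintegral_comp_tan_mul_cos_le {h : ℝ → ℝ≥0∞} (hh : Measurable h) (s : ℝ) :
    ∫⁻ θ in Ioc 0 (2 * π), ∫⁻ ρ in Ioc 0 (π / 2),
        h (-tan ρ * cos (θ - s)) * ENNReal.ofReal (sin ρ)
      ≤ ENNReal.ofReal (2 * π) * ∫⁻ t, h t :=
  calc ∫⁻ θ in Ioc 0 (2 * π), ∫⁻ ρ in Ioc 0 (π / 2),
        h (-tan ρ * cos (θ - s)) * ENNReal.ofReal (sin ρ)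
      ≤ ∫⁻ θ in Ioc 0 (2 * π), ∫⁻ t, h t * ENNReal.ofReal (radonKernel t (cos (θ - s))) :=
        lintegral_mono_ae <| (ae_restrict_of_ae (ae_cos_sub_ne_zero s)).mono
          fun _ hθ => lintegral_comp_tan_mul_le h hθ
    _ = ∫⁻ t, ∫⁻ θ in Ioc 0 (2 * π), h t * ENNReal.ofReal (radonKernel t (cos (θ - s))) :=
        lintegral_lintegral_swap (measurable_comp_tan_mul_cos hh s).aemeasurable
    _ ≤ ∫⁻ t, h t * ENNReal.ofReal (2 * π) := by
        refine lintegral_mono fun t => ?_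
        rw [lintegral_const_mul]
        · exact mul_le_mul_right (lintegral_radonKernel_cos_le t s) _
        · exact ENNReal.measurable_ofReal.comp <|
            measurable_radonKernel.comp (measurable_const.prodMk (by fun_prop))
    _ = _ := by rw [lintegral_mul_const _ hh, mul_comm]

lemma lintegral_sq_le_measure_mul_lintegral_sq {α : Type*} [MeasurableSpace α] (μ : Measure α)
    {g : α → ℝ≥0∞} (hg : AEMeasurable g μ) :
    (∫⁻ x, g x ∂μ) ^ 2 ≤ μ univ * ∫⁻ x, g x ^ 2 ∂μ := by
  have h := ENNReal.lintegral_mul_le_Lp_mul_Lq μ Real.HolderConjugate.two_two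
    (aemeasurable_const (b := (1 : ℝ≥0∞))) hg
  simp only [Pi.mul_apply, one_mul, ENNReal.one_rpow, lintegral_const] at h
  refine (pow_le_pow_left' h 2).trans_eq ?_
  rw [mul_pow, ← ENNReal.rpow_natCast, ← ENNReal.rpow_natCast, ← ENNReal.rpow_mul,
    ← ENNReal.rpow_mul]
  norm_num

/-- The absolute version of the Radon transform is bounded on `L²`. -/
lemma lintegral_sq_radon_le {g : ℝ → ℝ → ℝ≥0∞} (hg : Measurable (Function.uncurry g)) :
    ∫⁻ θ in Ioc 0 (2 * π), ∫⁻ ρ in Ioc 0 (π / 2),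
        (ENNReal.ofReal (1 / (2 * π)) *
          ∫⁻ s in Ioc 0 (2 * π), g s (-tan ρ * cos (θ - s))) ^ 2 * ENNReal.ofReal (sin ρ)
      ≤ ∫⁻ s in Ioc 0 (2 * π), ∫⁻ t, g s t ^ 2 := by
  have hcancel : ENNReal.ofReal (1 / (2 * π)) * ENNReal.ofReal (2 * π) = 1 := by
    rw [← ENNReal.ofReal_mul (by positivity), one_div_mul_cancel two_pi_pos.ne',
      ENNReal.ofReal_one]
  have htan : Measurable tan := by
    have : tan = fun x => sin x / cos x := funext tan_eq_sin_div_cos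
    rw [this]; fun_prop
  have hjoint : Measurable fun p : (ℝ × ℝ) × ℝ =>
      g p.2 (-tan p.1.2 * cos (p.1.1 - p.2)) :=
    hg.comp (measurable_snd.prodMk (by fun_prop))
  have hjoint2 : Measurable fun p : (ℝ × ℝ) × ℝ =>
      g p.2 (-tan p.1.2 * cos (p.1.1 - p.2)) ^ 2 * ENNReal.ofReal (sin p.1.2) :=
    (hjoint.pow_const 2).mul (by fun_prop)
  calc ∫⁻ θ in Ioc 0 (2 * π), ∫⁻ ρ in Ioc 0 (π / 2),
        (ENNReal.ofReal (1 / (2 * π)) *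
          ∫⁻ s in Ioc 0 (2 * π), g s (-tan ρ * cos (θ - s))) ^ 2 * ENNReal.ofReal (sin ρ)
      ≤ ∫⁻ θ in Ioc 0 (2 * π), ∫⁻ ρ in Ioc 0 (π / 2), ENNReal.ofReal (1 / (2 * π)) *
          ∫⁻ s in Ioc 0 (2 * π),
            g s (-tan ρ * cos (θ - s)) ^ 2 * ENNReal.ofReal (sin ρ) := by
        refine lintegral_mono fun θ => lintegral_mono fun ρ => ?_
        have hs : Measurable fun s => g s (-tan ρ * cos (θ - s)) :=
          hjoint.comp (measurable_prodMk_left (x := (θ, ρ)))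
        have hsin : ∫⁻ s in Ioc 0 (2 * π),
              g s (-tan ρ * cos (θ - s)) ^ 2 * ENNReal.ofReal (sin ρ)
            = (∫⁻ s in Ioc 0 (2 * π), g s (-tan ρ * cos (θ - s)) ^ 2)
              * ENNReal.ofReal (sin ρ) := lintegral_mul_const _ (hs.pow_const 2)
        rw [hsin, ← mul_assoc]
        refine mul_le_mul_left ?_ _
        have hcs := lintegral_sq_le_measure_mul_lintegral_sq
          (volume.restrict (Ioc 0 (2 * π))) hs.aemeasurable
        rw [Measure.restrict_apply_univ, Real.volume_Ioc, sub_zero] at hcs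
        rw [mul_pow]
        refine (mul_le_mul_right hcs _).trans_eq ?_
        rw [sq, ← mul_assoc, mul_assoc (ENNReal.ofReal (1 / (2 * π))), hcancel, mul_one]
    _ = ENNReal.ofReal (1 / (2 * π)) *
          ∫⁻ θ in Ioc 0 (2 * π), ∫⁻ ρ in Ioc 0 (π / 2), ∫⁻ s in Ioc 0 (2 * π),
            g s (-tan ρ * cos (θ - s)) ^ 2 * ENNReal.ofReal (sin ρ) := by
        rw [← lintegral_const_mul' _ _ ENNReal.ofReal_ne_top]
        exact lintegral_congr fun θ => lintegral_const_mul' _ _ ENNReal.ofReal_ne_top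
    _ = ENNReal.ofReal (1 / (2 * π)) *
          ∫⁻ θ in Ioc 0 (2 * π), ∫⁻ s in Ioc 0 (2 * π), ∫⁻ ρ in Ioc 0 (π / 2),
            g s (-tan ρ * cos (θ - s)) ^ 2 * ENNReal.ofReal (sin ρ) := by
        congr 1
        refine lintegral_congr fun θ => lintegral_lintegral_swap ?_
        exact (hjoint2.comp (f := fun p : ℝ × ℝ => ((θ, p.1), p.2)) (by fun_prop)).aemeasurable
    _ = ENNReal.ofReal (1 / (2 * π)) *
          ∫⁻ s in Ioc 0 (2 * π), ∫⁻ θ in Ioc 0 (2 * π), ∫⁻ ρ in Ioc 0 (π / 2),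
            g s (-tan ρ * cos (θ - s)) ^ 2 * ENNReal.ofReal (sin ρ) := by
        congr 1
        refine lintegral_lintegral_swap (Measurable.aemeasurable ?_)
        exact (hjoint2.comp (f := fun p : (ℝ × ℝ) × ℝ => ((p.1.1, p.2), p.1.2))
          (by fun_prop)).lintegral_prod_right'
    _ ≤ ENNReal.ofReal (1 / (2 * π)) *
          ∫⁻ s in Ioc 0 (2 * π), ENNReal.ofReal (2 * π) * ∫⁻ t, g s t ^ 2 := by
        refine mul_le_mul_right (lintegral_mono fun s => ?_) _
        exact lintegral_lintegral_comp_tan_mul_cos_le (h := fun t => g s t ^ 2)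
          ((hg.comp (measurable_prodMk_left (x := s))).pow_const 2) s
    _ = _ := by
        rw [lintegral_const_mul' _ _ ENNReal.ofReal_ne_top, ← mul_assoc, hcancel, one_mul]

/-- continuity of the parametric Radon transform `R` with norm bound `√2`. -/
theorem statement0 (f : ℝ → ℝ → ℂ)
    (hmeas : Measurable (Function.uncurry f))
    (hper : ∀ s t : ℝ, f (s + 2 * π) t = f s t)
    (heven : ∀ s t : ℝ, f (s + π) (-t) = f s t)
    (hL2 : (∫⁻ s in Set.Ioc (0:ℝ) (2 * π), ∫⁻ t : ℝ, (‖f s t‖₊ : ℝ≥0∞) ^ 2) < ⊤) :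
    ((∫⁻ θ in Set.Ioc (0:ℝ) (2 * π), ∫⁻ ρ in Set.Ioc (0:ℝ) (π / 2),
        (ENNReal.ofReal (1 / (2 * π)) *
            ∫⁻ s in Set.Ioc (0:ℝ) (2 * π),
              (‖f s (-Real.tan ρ * Real.cos (θ - s))‖₊ : ℝ≥0∞)) ^ 2
          * ENNReal.ofReal (Real.sin ρ))
      ≤ ∫⁻ s in Set.Ioc (0:ℝ) (2 * π), ∫⁻ t : ℝ, (‖f s t‖₊ : ℝ≥0∞) ^ 2) ∧
    (∀ᵐ θ ∂(volume.restrict (Set.Ioc (0:ℝ) (2 * π))),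
      ∀ᵐ ρ ∂(volume.restrict (Set.Ioc (0:ℝ) (π / 2))),
        IntegrableOn (fun s => f s (-Real.tan ρ * Real.cos (θ - s)))
          (Set.Ioc (0:ℝ) (2 * π))) ∧
    (2 * (∫⁻ θ in Set.Ioc (0:ℝ) (2 * π), ∫⁻ ρ in Set.Ioc (0:ℝ) (π / 2),
        (‖RT f θ ρ‖₊ : ℝ≥0∞) ^ 2 * ENNReal.ofReal (Real.sin ρ))
      ≤ 2 * ∫⁻ s in Set.Ioc (0:ℝ) (2 * π), ∫⁻ t : ℝ, (‖f s t‖₊ : ℝ≥0∞) ^ 2) := by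
  have hnorm : Measurable (Function.uncurry fun s t => (‖f s t‖₊ : ℝ≥0∞)) :=
    hmeas.nnnorm.coe_nnreal_ennreal
  have hbound := lintegral_sq_radon_le hnorm
  have htan : Measurable tan := by
    have : tan = fun x => sin x / cos x := funext tan_eq_sin_div_cos
    rw [this]; fun_prop
  have hjoint : Measurable fun p : (ℝ × ℝ) × ℝ => f p.2 (-tan p.1.2 * cos (p.1.1 - p.2)) :=
    hmeas.comp (f := fun p : (ℝ × ℝ) × ℝ => (p.2, -tan p.1.2 * cos (p.1.1 - p.2)))
      (measurable_snd.prodMk (by fun_prop))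
  have hinner : Measurable fun p : ℝ × ℝ =>
      (ENNReal.ofReal (1 / (2 * π)) * ∫⁻ s in Ioc 0 (2 * π),
        (‖f s (-tan p.2 * cos (p.1 - s))‖₊ : ℝ≥0∞)) ^ 2 * ENNReal.ofReal (sin p.2) :=
    ((hjoint.nnnorm.coe_nnreal_ennreal.lintegral_prod_right'.const_mul _).pow_const 2).mul
      (by fun_prop)
  refine ⟨hbound, ?_, mul_le_mul_right (le_trans ?_ hbound) _⟩
  · filter_upwards [ae_lt_top hinner.lintegral_prod_right' (hbound.trans_lt hL2).ne] with θ hθ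
    filter_upwards [ae_lt_top (hinner.comp (measurable_prodMk_left (x := θ))) hθ.ne,
      ae_restrict_mem measurableSet_Ioc] with ρ hρ hmem
    have hsin : ENNReal.ofReal (sin ρ) ≠ 0 :=
      (ENNReal.ofReal_pos.2 (sin_pos_of_pos_of_lt_pi hmem.1
        (by linarith [hmem.2, Real.pi_pos]))).ne'
    have hc : ENNReal.ofReal (1 / (2 * π)) ≠ 0 :=
      (ENNReal.ofReal_pos.2 (by positivity)).ne'
    refine ⟨(hjoint.comp (measurable_prodMk_left (x := (θ, ρ)))).aestronglyMeasurable, ?_⟩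
    have hsq := ENNReal.lt_top_of_mul_ne_top_left hρ.ne hsin
    rw [ENNReal.pow_lt_top_iff] at hsq
    exact ENNReal.lt_top_of_mul_ne_top_right (hsq.resolve_right two_ne_zero).ne hc
  · refine lintegral_mono fun θ => lintegral_mono fun ρ =>
      mul_le_mul_left (pow_le_pow_left' ?_ 2) _
    rw [RT, nnnorm_mul, ENNReal.coe_mul, intervalIntegral.integral_of_le two_pi_pos.le]
    refine mul_le_mul' (le_of_eq ?_) (enorm_integral_le_lintegral_enorm _)
    rw [← enorm_eq_nnnorm, ← ofReal_norm]
    congr 1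
    simp [abs_of_pos Real.pi_pos]
end

section
/- Let f : ℝ×ℝ → ℂ be continuous and 2π-periodic in its first variable. Then Rf(θ,ρ) = 0 for all θ ∈ ℝ and all ρ ∈ [0,π] with ρ ≠ π/2 if and only if the even part f_e(s,t) = (f(s,t) + f(s+π,−t))/2 of f has Fourier coefficients F_nᵉ(t) = (1/(2π)) ∫₀^{2π} f_e(s,t) e^{−ins} ds satisfying: F_nᵉ(t) = 0 for all t whenever |n| ≤ 1, and for each n with |n| ≥ 2 there exist complex numbers a_1, …, a_{⌊|n|/2⌋} such that F_nᵉ(t) = Σ_{m=1}^{⌊|n|/2⌋} a_m · t^{|n|−2m} for all t ∈ ℝ. -/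
open MeasureTheory Real Filter Set Topology ENNReal NNReal

/-- The even part of a function on the cylinder. -/
noncomputable def evenPart (f : ℝ → ℝ → ℂ) (s t : ℝ) : ℂ :=
  (f s t + f (s + π) (-t)) / 2


/-! ### The cosine transform `F ↦ ∫₀^{2π} F (r cos u) cos (n u) du` -/

/-- `r ↦ ∫₀^{2π} F (r cos u) cos (n u) du`. -/
noncomputable def cosTransform (n : ℕ) (F : ℝ → ℂ) (r : ℝ) : ℂ :=
  ∫ u in (0:ℝ)..(2 * π), F (r * Real.cos u) * (Real.cos (n * u) : ℂ)

lemma hasDerivAt_cos_natCast_mul (n : ℕ) (u : ℝ) :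
    HasDerivAt (fun u : ℝ => Real.cos (n * u)) (-(n * Real.sin (n * u))) u := by
  have h : HasDerivAt (fun u : ℝ => (n : ℝ) * u) n u := by
    simpa using (hasDerivAt_id u).const_mul (n : ℝ)
  have := h.cos
  convert this using 1
  ring

lemma hasDerivAt_sin_natCast_mul (n : ℕ) (u : ℝ) :
    HasDerivAt (fun u : ℝ => Real.sin (n * u)) (n * Real.cos (n * u)) u := by
  have h : HasDerivAt (fun u : ℝ => (n : ℝ) * u) n u := by
    simpa using (hasDerivAt_id u).const_mul (n : ℝ)
  have := h.sin
  convert this using 1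
  ring

/-- Integration by parts for the cosine transform. -/
lemma natCast_mul_cosTransform (n : ℕ) {F Φ : ℝ → ℂ} (hF : Continuous F)
    (hΦ : ∀ t, HasDerivAt Φ (F t) t) (r : ℝ) :
    n * cosTransform n Φ r =
      r * ∫ u in (0:ℝ)..(2 * π),
        F (r * Real.cos u) * ((Real.sin u : ℂ) * (Real.sin (n * u) : ℂ)) := by
  have hΦc : Continuous Φ := continuous_iff_continuousAt.2 fun t => (hΦ t).continuousAt
  have hder : ∀ u : ℝ, HasDerivAt (fun u : ℝ => Φ (r * Real.cos u) * (Real.sin (n * u) : ℂ))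
      (n * (Φ (r * Real.cos u) * (Real.cos (n * u) : ℂ)) -
        r * (F (r * Real.cos u) * ((Real.sin u : ℂ) * (Real.sin (n * u) : ℂ)))) u := by
    intro u
    have h1 : HasDerivAt (fun u : ℝ => r * Real.cos u) (r * -Real.sin u) u :=
      (Real.hasDerivAt_cos u).const_mul r
    have h2 := (hΦ (r * Real.cos u)).scomp u h1
    have h3 := h2.mul (hasDerivAt_sin_natCast_mul n u).ofReal_comp
    refine h3.congr_deriv ?_
    simp only [Function.comp, Complex.real_smul]
    push_cast
    ring
  have hint := intervalIntegral.integral_eq_sub_of_hasDerivAt (a := 0) (b := 2 * π)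
    (fun u _ => hder u) (Continuous.intervalIntegrable (by fun_prop) _ _)
  rw [intervalIntegral.integral_sub (Continuous.intervalIntegrable (by fun_prop) _ _)
    (Continuous.intervalIntegrable (by fun_prop) _ _),
    intervalIntegral.integral_const_mul, intervalIntegral.integral_const_mul] at hint
  have hs : Real.sin (n * (2 * π)) = 0 := by
    have := Real.sin_nat_mul_pi (2 * n)
    rw [← this]; push_cast; ring_nf
  rw [hs] at hint
  simp only [mul_zero, Real.sin_zero, Complex.ofReal_zero, sub_zero] at hint
  exact sub_eq_zero.1 hint

lemma hasDerivAt_cosTransform (n : ℕ) {F Φ : ℝ → ℂ} (hF : Continuous F)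
    (hΦ : ∀ t, HasDerivAt Φ (F t) t) (r : ℝ) :
    HasDerivAt (cosTransform n Φ)
      (∫ u in (0:ℝ)..(2 * π),
        F (r * Real.cos u) * ((Real.cos u : ℂ) * (Real.cos (n * u) : ℂ))) r := by
  have hΦc : Continuous Φ := continuous_iff_continuousAt.2 fun t => (hΦ t).continuousAt
  obtain ⟨C, hC⟩ := (isCompact_Icc (a := -(|r| + 1)) (b := |r| + 1)).exists_bound_of_continuousOn
    hF.continuousOn
  refine (intervalIntegral.hasDerivAt_integral_of_dominated_loc_of_deriv_le
    (F := fun (x : ℝ) u => Φ (x * Real.cos u) * (Real.cos (n * u) : ℂ))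
    (F' := fun (x : ℝ) u => F (x * Real.cos u) * ((Real.cos u : ℂ) * (Real.cos (n * u) : ℂ)))
    (bound := fun _ => C) (Metric.ball_mem_nhds r one_pos)
    (.of_forall fun x => Continuous.aestronglyMeasurable (by fun_prop))
    (Continuous.intervalIntegrable (by fun_prop) _ _)
    (Continuous.aestronglyMeasurable (by fun_prop)) (.of_forall fun u _ x hx => ?_)
    (Continuous.intervalIntegrable (by fun_prop) _ _)
    (.of_forall fun u _ x hx => ?_)).2
  · have hx' : |x| ≤ |r| + 1 := by
      have h1 : |x - r| < 1 := by simpa [Real.dist_eq] using hx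
      have h2 := abs_sub_abs_le_abs_sub x r
      linarith
    have hxc : |x * Real.cos u| ≤ |r| + 1 := by
      rw [abs_mul]
      exact (mul_le_of_le_one_right (abs_nonneg x) (Real.abs_cos_le_one u)).trans hx'
    have h1 := hC _ (Set.mem_Icc.2 (abs_le.1 hxc))
    have h2 : ‖(Real.cos u : ℂ) * (Real.cos (n * u) : ℂ)‖ ≤ 1 := by
      rw [norm_mul, Complex.norm_real, Complex.norm_real]
      exact mul_le_one₀ (Real.abs_cos_le_one _) (norm_nonneg _) (Real.abs_cos_le_one _)
    rw [norm_mul]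
    exact (mul_le_of_le_one_right (norm_nonneg _) h2).trans h1
  · have h1 : HasDerivAt (fun x : ℝ => x * Real.cos u) (Real.cos u) x := by
      simpa using (hasDerivAt_id x).mul_const (Real.cos u)
    have h2 := ((hΦ (x * Real.cos u)).scomp x h1).mul_const (Real.cos (n * u) : ℂ)
    refine h2.congr_deriv ?_
    simp only [Complex.real_smul]
    ring

/-- The Euler operator of degree `n` applied to the transform of order `n` of a primitive of `F` is
`r` times the transform of order `n + 1` of `F`. -/
lemma mul_deriv_cosTransform (n : ℕ) {F Φ : ℝ → ℂ} (hF : Continuous F)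
    (hΦ : ∀ t, HasDerivAt Φ (F t) t) (r : ℝ) :
    r * deriv (cosTransform n Φ) r - n * cosTransform n Φ r = r * cosTransform (n + 1) F r := by
  rw [(hasDerivAt_cosTransform n hF hΦ r).deriv, natCast_mul_cosTransform n hF hΦ r, ← mul_sub,
    ← intervalIntegral.integral_sub (Continuous.intervalIntegrable (by fun_prop) _ _)
    (Continuous.intervalIntegrable (by fun_prop) _ _), cosTransform]
  congr 2
  ext u
  have : Real.cos ((n + 1 : ℕ) * u) =
      Real.cos u * Real.cos (n * u) - Real.sin u * Real.sin (n * u) := by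
    push_cast
    rw [add_mul, one_mul, Real.cos_add]
    ring
  rw [this]
  push_cast
  ring

/-- `∫₀^{2π} cos^k u cos (n u) du`. -/
noncomputable def cosMoment (k n : ℕ) : ℂ :=
  ∫ u in (0:ℝ)..(2 * π), (Real.cos u : ℂ) ^ k * (Real.cos (n * u) : ℂ)

lemma cosTransform_pow (k n : ℕ) (r : ℝ) :
    cosTransform n (fun t => (t : ℂ) ^ k) r = r ^ k * cosMoment k n := by
  rw [cosTransform, cosMoment, ← intervalIntegral.integral_const_mul]
  congr 1
  ext u
  push_cast
  ring

lemma add_mul_cosMoment_succ (k n : ℕ) :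
    ((k + 1 : ℕ) + (n + 1 : ℕ) : ℂ) * cosMoment (k + 1) (n + 1) = (k + 1 : ℕ) * cosMoment k n := by
  have hF : Continuous fun t : ℝ => ((k + 1 : ℕ) : ℂ) * (t : ℂ) ^ k := by fun_prop
  have hΦ : ∀ t : ℝ, HasDerivAt (fun t : ℝ => (t : ℂ) ^ (k + 1))
      (((k + 1 : ℕ) : ℂ) * (t : ℂ) ^ k) t := fun t => by
    simpa using ((hasDerivAt_id t).ofReal_comp).fun_pow (k + 1)
  have h := natCast_mul_cosTransform (n + 1) hF hΦ 1
  rw [cosTransform_pow] at h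
  simp only [Complex.ofReal_one, one_pow, one_mul] at h
  rw [add_mul, h, cosMoment, cosMoment, ← intervalIntegral.integral_const_mul,
    ← intervalIntegral.integral_const_mul,
    ← intervalIntegral.integral_add (Continuous.intervalIntegrable (by fun_prop) _ _)
    (Continuous.intervalIntegrable (by fun_prop) _ _)]
  congr 1
  ext u
  have : Real.cos (n * u) =
      Real.cos ((n + 1 : ℕ) * u) * Real.cos u + Real.sin ((n + 1 : ℕ) * u) * Real.sin u := by
    rw [← Real.cos_sub]
    congr 1
    push_cast
    ring
  rw [this]
  push_cast
  ring

lemma cosMoment_self_ne_zero (n : ℕ) : cosMoment n n ≠ 0 := by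
  induction n with
  | zero => simp [cosMoment, Real.pi_ne_zero]
  | succ n ih =>
    intro h
    have := add_mul_cosMoment_succ n n
    rw [h, mul_zero] at this
    exact mul_ne_zero (Nat.cast_ne_zero.2 n.succ_ne_zero) ih this.symm

lemma cosMoment_eq_zero_of_lt {k n : ℕ} (h : k < n) : cosMoment k n = 0 := by
  induction k generalizing n with
  | zero =>
    have hn : (n : ℝ) ≠ 0 := by positivity
    have hs : Real.sin (n * (2 * π)) = 0 := by
      rw [← Real.sin_nat_mul_pi (2 * n)]; push_cast; ring_nf
    simp only [cosMoment, pow_zero, one_mul]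
    rw [intervalIntegral.integral_ofReal,
      intervalIntegral.integral_comp_mul_left (fun x => Real.cos x) hn, integral_cos]
    simp [hs]
  | succ k ih =>
    obtain ⟨n, rfl⟩ := Nat.exists_eq_succ_of_ne_zero (by lia : n ≠ 0)
    have := add_mul_cosMoment_succ k n
    rw [ih (by lia), mul_zero] at this
    refine (mul_eq_zero.1 this).resolve_left ?_
    exact_mod_cast (by lia : k + 1 + (n + 1) ≠ 0)

lemma integral_sqrt_sub_sq_eq_zero {a : ℝ} (ha : a ≤ 0) :
    ∫ y : ℝ, Real.sqrt (a - y ^ 2) = 0 := by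
  have h (y : ℝ) : Real.sqrt (a - y ^ 2) = 0 :=
    Real.sqrt_eq_zero_of_nonpos (by nlinarith [sq_nonneg y])
  simp [h]

/-- The area of a half disc. -/
lemma integral_sqrt_sq_sub_sq {a : ℝ} (ha : 0 < a) :
    ∫ y : ℝ, Real.sqrt (a ^ 2 - y ^ 2) = a ^ 2 * (π / 2) := by
  have h1 : ∫ y : ℝ, Real.sqrt (1 - y ^ 2) = π / 2 := by
    rw [← integral_sqrt_one_sub_sq, intervalIntegral.integral_of_le (by norm_num),
      setIntegral_eq_integral_of_forall_compl_eq_zero]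
    intro x hx
    refine Real.sqrt_eq_zero_of_nonpos ?_
    simp only [Set.mem_Ioc, not_and_or, not_lt, not_le] at hx
    rcases hx with hx | hx <;> nlinarith
  have h2 := Measure.integral_comp_mul_left (fun y => Real.sqrt (a ^ 2 - y ^ 2)) a
  have h3 : ∀ y : ℝ, Real.sqrt (a ^ 2 - (a * y) ^ 2) = a * Real.sqrt (1 - y ^ 2) := fun y => by
    rw [show a ^ 2 - (a * y) ^ 2 = a ^ 2 * (1 - y ^ 2) by ring, Real.sqrt_mul (sq_nonneg a),
      Real.sqrt_sq ha.le]
  simp only [h3] at h2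
  rw [integral_const_mul, h1, abs_of_pos (inv_pos.2 ha), smul_eq_mul] at h2
  field_simp at h2
  linarith

/-- Obtained by integrating `F x * √(R² - x² - y²)` over the disc of radius `R`, in polar and in
Cartesian coordinates. -/
lemma integral_sq_sub_sq_eq_zero {F : ℝ → ℂ} (hF : Continuous F)
    (h : ∀ r : ℝ, 0 < r → cosTransform 0 F r = 0) {R : ℝ} (hR : 0 < R) :
    ∫ x in (-R)..R, F x * ((R ^ 2 - x ^ 2 : ℝ) : ℂ) = 0 := by
  set g : ℝ × ℝ → ℂ := fun p => F p.1 * (Real.sqrt (R ^ 2 - p.1 ^ 2 - p.2 ^ 2) : ℂ) with hg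
  have hgc : Continuous g := by fun_prop
  have hgi : Integrable g := by
    refine hgc.integrable_of_hasCompactSupport ?_
    refine HasCompactSupport.intro ((isCompact_Icc (a := -R) (b := R)).prod
      (isCompact_Icc (a := -R) (b := R))) fun p hp => ?_
    have : R ^ 2 - p.1 ^ 2 - p.2 ^ 2 ≤ 0 := by
      by_contra! hlt
      refine hp ⟨abs_le.1 (abs_le_of_sq_le_sq ?_ hR.le), abs_le.1 (abs_le_of_sq_le_sq ?_ hR.le)⟩ <;>
        nlinarith [sq_nonneg p.1, sq_nonneg p.2]
    simp [hg, Real.sqrt_eq_zero_of_nonpos this]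
  have hpolar : ∫ p, g p = 0 := by
    rw [← integral_comp_polarCoord_symm, polarCoord_target]
    by_cases hi : IntegrableOn (fun p : ℝ × ℝ => p.1 • g (polarCoord.symm p))
        (Set.Ioi 0 ×ˢ Set.Ioo (-π) π) (volume.prod volume)
    · rw [Measure.volume_eq_prod, setIntegral_prod _ hi]
      refine setIntegral_eq_zero_of_forall_eq_zero fun r hr => ?_
      have hr : 0 < r := hr
      have hc := h r hr
      simp only [cosTransform, Nat.cast_zero, zero_mul, Real.cos_zero, Complex.ofReal_one,
        mul_one] at hc
      have hp : Function.Periodic (fun u => F (r * Real.cos u)) (2 * π) := fun u => by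
        simp
      have hshift := hp.intervalIntegral_add_eq (-π) 0
      rw [zero_add, hc, show -π + 2 * π = π by ring] at hshift
      rw [← integral_Ioc_eq_integral_Ioo, ← intervalIntegral.integral_of_le (by linarith [Real.pi_pos])]
      have : ∀ u : ℝ, r • g (polarCoord.symm (r, u)) =
          F (r * Real.cos u) * (r * (Real.sqrt (R ^ 2 - r ^ 2) : ℂ)) := fun u => by
        have hsq : R ^ 2 - (r * Real.cos u) ^ 2 - (r * Real.sin u) ^ 2 = R ^ 2 - r ^ 2 := by
          linear_combination -r ^ 2 * Real.sin_sq_add_cos_sq u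
        simp only [hg, polarCoord_symm_apply, hsq, Complex.real_smul]
        ring
      simp only [this]
      rw [intervalIntegral.integral_mul_const, hshift, zero_mul]
    · exact integral_undef hi
  rw [Measure.volume_eq_prod, integral_prod _ hgi] at hpolar
  have hin : ∀ x : ℝ, ∫ y, g (x, y) = if x ∈ Set.Ioc (-R) R then
      F x * ((R ^ 2 - x ^ 2 : ℝ) : ℂ) * ((π / 2 : ℝ) : ℂ) else 0 := fun x => by
    simp only [hg]
    rw [integral_const_mul, integral_complex_ofReal]
    rcases le_or_gt (R ^ 2 - x ^ 2) 0 with hle | hlt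
    · rw [integral_sqrt_sub_sq_eq_zero hle]
      split_ifs with hx
      · have : R ^ 2 - x ^ 2 = 0 := le_antisymm hle (by nlinarith [hx.1, hx.2])
        simp [this]
      · simp
    · have hx : |x| ≤ R := abs_le_of_sq_le_sq (by linarith) hR.le
      have hx1 : x ≠ -R := by rintro rfl; simp at hlt
      have hx2 := abs_le.1 hx
      rw [if_pos ⟨lt_of_le_of_ne hx2.1 hx1.symm, hx2.2⟩]
      have := integral_sqrt_sq_sub_sq (Real.sqrt_pos.2 hlt)
      rw [Real.sq_sqrt hlt.le] at this
      rw [this]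
      push_cast
      ring
  simp only [hin] at hpolar
  have := integral_indicator (μ := volume) (measurableSet_Ioc (a := -R) (b := R))
    (f := fun x => F x * ((R ^ 2 - x ^ 2 : ℝ) : ℂ) * ((π / 2 : ℝ) : ℂ))
  simp only [Set.indicator_apply] at this
  rw [this, ← intervalIntegral.integral_of_le (by linarith),
    intervalIntegral.integral_mul_const] at hpolar
  refine (mul_eq_zero.1 hpolar).resolve_right ?_
  exact_mod_cast (by positivity : π / 2 ≠ 0)

/-- An even continuous function with vanishing transform of order zero vanishes. -/
lemma eq_zero_of_cosTransform_zero {F : ℝ → ℂ} (hF : Continuous F) (heven : ∀ t, F (-t) = F t)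
    (h : ∀ r : ℝ, 0 < r → cosTransform 0 F r = 0) (t : ℝ) : F t = 0 := by
  have hG : Continuous fun x : ℝ => F x * ((x ^ 2 : ℝ) : ℂ) := by fun_prop
  have hhalf : ∀ R : ℝ, 0 < R →
      ((R ^ 2 : ℝ) : ℂ) * (∫ x in (0:ℝ)..R, F x) - ∫ x in (0:ℝ)..R, F x * ((x ^ 2 : ℝ) : ℂ) = 0 := by
    intro R hR
    have h0 := integral_sq_sub_sq_eq_zero hF h hR
    have hc : Continuous fun x : ℝ => F x * ((R ^ 2 - x ^ 2 : ℝ) : ℂ) := by fun_prop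
    rw [← intervalIntegral.integral_add_adjacent_intervals (hc.intervalIntegrable (-R) 0)
      (hc.intervalIntegrable 0 R)] at h0
    have hneg := intervalIntegral.integral_comp_neg
      (fun x : ℝ => F x * ((R ^ 2 - x ^ 2 : ℝ) : ℂ)) (a := 0) (b := R)
    simp only [heven, neg_sq, neg_zero] at hneg
    rw [← hneg, ← two_mul] at h0
    rw [← intervalIntegral.integral_const_mul, ← intervalIntegral.integral_sub
      (Continuous.intervalIntegrable (by fun_prop) _ _) (hG.intervalIntegrable _ _),
      ← (mul_eq_zero.1 h0).resolve_left two_ne_zero]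
    congr 1
    ext x
    push_cast
    ring
  have hH : ∀ R : ℝ, HasDerivAt (fun R => ∫ x in (0:ℝ)..R, F x) (F R) R := fun R =>
    (hF.integral_hasStrictDerivAt 0 R).hasDerivAt
  have hprim : ∀ R : ℝ, 0 < R → ∫ x in (0:ℝ)..R, F x = 0 := by
    intro R hR
    have hsq : HasDerivAt (fun R : ℝ => ((R ^ 2 : ℝ) : ℂ)) ((2 * R : ℝ) : ℂ) R := by
      have : HasDerivAt (fun R : ℝ => R ^ 2) (2 * R) R := by simpa using hasDerivAt_pow 2 R
      exact this.ofReal_comp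
    have h1 := (hsq.mul (hH R)).sub (hG.integral_hasStrictDerivAt 0 R).hasDerivAt
    have h2 : HasDerivAt (fun _ : ℝ => (0 : ℂ)) 0 R := hasDerivAt_const R 0
    have h3 := h1.congr_of_eventuallyEq (f₁ := fun _ => (0 : ℂ))
      ((eventually_gt_nhds hR).mono fun x hx => (hhalf x hx).symm)
    have h4 := h2.unique h3
    have h5 : ((2 * R : ℝ) : ℂ) * ∫ x in (0:ℝ)..R, F x = 0 := by
      rw [h4]; ring
    refine (mul_eq_zero.1 h5).resolve_left ?_
    exact_mod_cast (by positivity : 2 * R ≠ 0)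
  have hpos : ∀ R : ℝ, 0 < R → F R = 0 := by
    intro R hR
    have h3 := (hH R).congr_of_eventuallyEq (f₁ := fun _ => (0 : ℂ))
      ((eventually_gt_nhds hR).mono fun x hx => (hprim x hx).symm)
    exact (hasDerivAt_const R (0 : ℂ)).unique h3 |>.symm
  have hzero : F 0 = 0 := by
    have h1 : Tendsto F (𝓝[>] 0) (𝓝 (F 0)) := hF.continuousAt.tendsto.mono_left nhdsWithin_le_nhds
    have h2 : Tendsto F (𝓝[>] 0) (𝓝 0) :=
      tendsto_const_nhds.congr' (eventually_nhdsWithin_of_forall fun x hx => (hpos x hx).symm)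
    exact tendsto_nhds_unique h1 h2
  rcases lt_trichotomy t 0 with ht | rfl | ht
  · rw [← heven]; exact hpos _ (by linarith)
  · exact hzero
  · exact hpos t ht

lemma cosTransform_sub (n : ℕ) {F G : ℝ → ℂ} (hF : Continuous F) (hG : Continuous G) (r : ℝ) :
    cosTransform n (fun t => F t - G t) r = cosTransform n F r - cosTransform n G r := by
  simp only [cosTransform, sub_mul]
  exact intervalIntegral.integral_sub (Continuous.intervalIntegrable (by fun_prop) _ _)
    (Continuous.intervalIntegrable (by fun_prop) _ _)

lemma cosTransform_const_mul (n : ℕ) (c : ℂ) (F : ℝ → ℂ) (r : ℝ) :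
    cosTransform n (fun t => c * F t) r = c * cosTransform n F r := by
  simp only [cosTransform, mul_assoc]
  exact intervalIntegral.integral_const_mul _ _

/-- A solution of the Euler equation on the half line is homogeneous. -/
lemma exists_eq_const_mul_pow (n : ℕ) {A : ℝ → ℂ} (hA : Differentiable ℝ A)
    (h : ∀ r : ℝ, 0 < r → r * deriv A r - n * A r = 0) :
    ∃ c : ℂ, ∀ r : ℝ, 0 < r → A r = c * (r : ℂ) ^ n := by
  have hpow : ∀ r : ℝ, HasDerivAt (fun r : ℝ => (r : ℂ) ^ n) (n * (r : ℂ) ^ (n - 1)) r := fun r => by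
    simpa using ((hasDerivAt_id r).ofReal_comp).fun_pow n
  have hder : ∀ r ∈ Set.Ioi (0:ℝ), HasDerivAt (fun r : ℝ => A r / (r : ℂ) ^ n) 0 r := by
    intro r hr
    have hr' : (r : ℂ) ≠ 0 := by exact_mod_cast (ne_of_gt hr)
    have h1 := (hA r).hasDerivAt.fun_div (hpow r) (pow_ne_zero n hr')
    refine h1.congr_deriv ?_
    have h2 := h r hr
    suffices hnum : deriv A r * (r : ℂ) ^ n - A r * (n * (r : ℂ) ^ (n - 1)) = 0 by
      rw [hnum]
      exact zero_div _
    rcases n with _ | n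
    · have : deriv A r = 0 := by simpa [hr'] using h2
      simp [this]
    · rw [Nat.add_sub_cancel]
      linear_combination (r : ℂ) ^ n * h2
  refine ⟨A 1 / ((1 : ℝ) : ℂ) ^ n, fun r hr => ?_⟩
  have h1 := isOpen_Ioi.is_const_of_deriv_eq_zero isPreconnected_Ioi
    (fun x hx => (hder x hx).differentiableAt.differentiableWithinAt)
    (fun x hx => (hder x hx).deriv) (Set.mem_Ioi.2 one_pos) (Set.mem_Ioi.2 hr)
  rw [h1, div_mul_cancel₀]
  exact pow_ne_zero n (by exact_mod_cast hr.ne')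

/-- The null space of the cosine transform of order `n` among continuous functions of parity `n`. -/
lemma exists_polynomial_of_cosTransform_eq_zero (n : ℕ) {F : ℝ → ℂ} (hF : Continuous F)
    (hpar : ∀ t, F (-t) = (-1) ^ n * F t) (h : ∀ r : ℝ, 0 < r → cosTransform n F r = 0) :
    ∃ a : ℕ → ℂ, ∀ t : ℝ,
      F t = ∑ m ∈ Finset.Icc 1 (n / 2), a m * (t : ℂ) ^ (n - 2 * m) := by
  induction n generalizing F with
  | zero => exact ⟨0, fun t => by simp [eq_zero_of_cosTransform_zero hF (by simpa using hpar) h t]⟩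
  | succ n ih =>
    set Φ : ℝ → ℂ := fun t => ∫ x in (0:ℝ)..t, F x with hΦdef
    have hΦ : ∀ t, HasDerivAt Φ (F t) t := fun t => (hF.integral_hasStrictDerivAt 0 t).hasDerivAt
    have hΦc : Continuous Φ := continuous_iff_continuousAt.2 fun t => (hΦ t).continuousAt
    have hΦpar : ∀ t, Φ (-t) = (-1) ^ n * Φ t := fun t => by
      have h1 := intervalIntegral.integral_comp_neg F (a := 0) (b := t)
      simp only [hpar, neg_zero] at h1
      rw [intervalIntegral.integral_const_mul] at h1
      simp only [hΦdef]
      rw [intervalIntegral.integral_symm, ← h1]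
      ring
    obtain ⟨c, hc⟩ := exists_eq_const_mul_pow n
      (fun r => (hasDerivAt_cosTransform n hF hΦ r).differentiableAt)
      (fun r hr => by rw [mul_deriv_cosTransform n hF hΦ r, h r hr, mul_zero])
    obtain ⟨a, ha⟩ := ih (F := fun t => Φ t - c / cosMoment n n * (t : ℂ) ^ n) (by fun_prop)
      (fun t => by
        rw [hΦpar]
        push_cast
        rw [neg_pow (t : ℂ)]
        ring)
      (fun r hr => by
        rw [cosTransform_sub n hΦc (by fun_prop), cosTransform_const_mul, cosTransform_pow, hc r hr]
        have := cosMoment_self_ne_zero n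
        field_simp
        ring)
    set b : ℕ → ℂ := fun m => if m = 0 then c / cosMoment n n else a m with hb
    have hΦeq : ∀ t : ℝ, Φ t = ∑ m ∈ Finset.range (n / 2 + 1), b m * (t : ℂ) ^ (n - 2 * m) := by
      intro t
      have hIcc : Finset.Icc 1 (n / 2) = Finset.Ico 1 (n / 2 + 1) := by ext; simp
      have h1 := ha t
      rw [hIcc, sub_eq_iff_eq_add] at h1
      rw [h1, Finset.range_eq_Ico, Finset.sum_eq_sum_Ico_succ_bot (Nat.succ_pos _), add_comm]
      refine congrArg₂ (· + ·) (by simp [hb]) ?_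
      refine Finset.sum_congr rfl fun m hm => ?_
      have : m ≠ 0 := by have := (Finset.mem_Ico.1 hm).1; lia
      simp [hb, this]
    have hFeq : ∀ t : ℝ, F t = ∑ m ∈ Finset.range (n / 2 + 1),
        b m * ((n - 2 * m : ℕ) * (t : ℂ) ^ (n - 2 * m - 1)) := by
      intro t
      refine (hΦ t).unique ?_
      rw [funext hΦeq]
      refine HasDerivAt.fun_sum fun m _ => HasDerivAt.const_mul _ ?_
      simpa using ((hasDerivAt_id t).ofReal_comp).fun_pow (n - 2 * m)
    refine ⟨fun m => b (m - 1) * (n - 2 * (m - 1) : ℕ), fun t => ?_⟩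
    have hIcc : Finset.Icc 1 ((n + 1) / 2) = Finset.Ico (0 + 1) ((n + 1) / 2 + 1) := by
      ext; simp
    rw [hFeq, hIcc, ← Finset.sum_Ico_add' _ 0 _ 1, ← Finset.range_eq_Ico]
    symm
    have hsub : Finset.range ((n + 1) / 2) ⊆ Finset.range (n / 2 + 1) := by
      intro m; simp; lia
    refine (Finset.sum_congr rfl fun m _ => ?_).trans (Finset.sum_subset hsub fun m hm hm' => ?_)
    · rw [show n + 1 - 2 * (m + 1) = n - 2 * m - 1 by lia]
      simp only [Nat.add_sub_cancel]
      ring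
    · have : n - 2 * m = 0 := by simp at hm hm'; lia
      simp [this]

lemma cosTransform_polynomial_eq_zero (n : ℕ) (hn : n ≠ 0) {F : ℝ → ℂ} {a : ℕ → ℂ}
    (hF : ∀ t : ℝ, F t = ∑ m ∈ Finset.Icc 1 (n / 2), a m * (t : ℂ) ^ (n - 2 * m)) (r : ℝ) :
    cosTransform n F r = 0 := by
  rw [funext hF, cosTransform]
  simp only [Finset.sum_mul]
  rw [intervalIntegral.integral_finsetSum
    fun m _ => Continuous.intervalIntegrable (by fun_prop) _ _]
  refine Finset.sum_eq_zero fun m hm => ?_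
  have h1 := cosTransform_const_mul n (a m) (fun t => (t : ℂ) ^ (n - 2 * m)) r
  rw [cosTransform_pow, cosMoment_eq_zero_of_lt (by have := (Finset.mem_Icc.1 hm).1; lia),
    mul_zero, mul_zero] at h1
  exact h1

/-! ### Fourier coefficients of the Radon transform -/

/-- A continuous periodic function with vanishing Fourier coefficients vanishes. -/
lemma eq_zero_of_integral_exp_eq_zero {g : ℝ → ℂ} (hg : Continuous g)
    (hper : Function.Periodic g (2 * π))
    (h : ∀ n : ℤ, ∫ θ in (0:ℝ)..(2 * π), g θ * Complex.exp (-Complex.I * n * θ) = 0) (θ : ℝ) :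
    g θ = 0 := by
  have : Fact (0 < 2 * π) := ⟨Real.two_pi_pos⟩
  let G : C(AddCircle (2 * π), ℂ) := ⟨hper.lift, hg.quotient_liftOn' _⟩
  have hG (x : ℝ) : G x = g x := hper.lift_coe x
  have hcoeff : fourierCoeff G = 0 := by
    ext n
    rw [fourierCoeff_eq_intervalIntegral _ n 0, zero_add]
    have : ∀ x : ℝ, fourier (-n) (x : AddCircle (2 * π)) • G x =
        g x * Complex.exp (-Complex.I * n * x) := fun x => by
      rw [hG, fourier_coe_apply, smul_eq_mul, mul_comm]
      congr 2
      have := Real.pi_ne_zero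
      push_cast
      field_simp
    simp only [this, h n, smul_zero, Pi.zero_apply]
  have hsum := has_pointwise_sum_fourier_series_of_summable (f := G)
    (by rw [hcoeff]; exact summable_zero) (θ : AddCircle (2 * π))
  simp only [hcoeff, Pi.zero_apply, zero_smul] at hsum
  rw [← hG]
  exact hsum.unique hasSum_zero

lemma intervalIntegral_swap_of_continuous {g : ℝ → ℝ → ℂ} (hg : Continuous (Function.uncurry g))
    (a b c d : ℝ) :
    ∫ x in a..b, ∫ y in c..d, g x y = ∫ y in c..d, ∫ x in a..b, g x y :=
  intervalIntegral_intervalIntegral_swap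
    ((hg.continuousOn.integrableOn_compact (isCompact_uIcc.prod isCompact_uIcc)).mono_set
      (Set.prod_mono Set.uIoc_subset_uIcc Set.uIoc_subset_uIcc))

lemma integral_shift_of_periodic {g : ℝ → ℂ} (hg : Function.Periodic g (2 * π)) (a : ℝ) :
    ∫ x in (0:ℝ)..(2 * π), g (x + a) = ∫ x in (0:ℝ)..(2 * π), g x := by
  rw [intervalIntegral.integral_comp_add_right, zero_add, add_comm (2 * π) a,
    hg.intervalIntegral_add_eq a 0, zero_add]

lemma exp_neg_I_mul_int_mul_add_two_pi (n : ℤ) (x : ℝ) :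
    Complex.exp (-Complex.I * n * (x + 2 * π : ℝ)) = Complex.exp (-Complex.I * n * x) := by
  have : -Complex.I * n * ((x + 2 * π : ℝ) : ℂ) =
      -Complex.I * n * x + (-n : ℤ) * (2 * π * Complex.I) := by
    push_cast
    ring
  rw [this, Complex.exp_add, Complex.exp_int_mul_two_pi_mul_I, mul_one]

lemma integral_mul_exp_eq_cosTransform (n : ℤ) {F : ℝ → ℂ} (hF : Continuous F) (r : ℝ) :
    ∫ u in (0:ℝ)..(2 * π), F (r * Real.cos u) * Complex.exp (-Complex.I * n * u) =
      cosTransform n.natAbs F r := by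
  set φ : ℝ → ℂ := fun u => F (r * Real.cos u) * Complex.exp (-Complex.I * n * u) with hφ
  have hφc : Continuous φ := by fun_prop
  have hper : Function.Periodic φ (2 * π) := fun u => by
    simp only [hφ]
    rw [exp_neg_I_mul_int_mul_add_two_pi n u, Real.cos_add_two_pi]
  have hrefl : ∫ u in (0:ℝ)..(2 * π), φ (-u) = ∫ u in (0:ℝ)..(2 * π), φ u := by
    have h1 := intervalIntegral.integral_comp_neg φ (a := 0) (b := 2 * π)
    have h2 := hper.intervalIntegral_add_eq (-(2 * π)) 0
    rw [h1, neg_zero]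
    simpa using h2
  have hcos : ∀ u : ℝ, (Real.cos (n.natAbs * u) : ℂ) =
      (Complex.exp (-Complex.I * n * u) + Complex.exp (-Complex.I * n * (-u : ℝ))) / 2 := by
    intro u
    have h1 : Real.cos (n.natAbs * u) = Real.cos (n * u) := by
      rw [Nat.cast_natAbs]
      rcases abs_choice n with h | h <;> rw [h]
      push_cast
      rw [neg_mul, Real.cos_neg]
    rw [h1, Complex.ofReal_cos, Complex.cos, add_comm]
    push_cast
    ring_nf
  have hsum : cosTransform n.natAbs F r = ∫ u in (0:ℝ)..(2 * π), (φ u + φ (-u)) / 2 := by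
    rw [cosTransform]
    congr 1
    ext u
    simp only [hφ, hcos u, Real.cos_neg]
    ring
  rw [hsum, intervalIntegral.integral_div, intervalIntegral.integral_add
    (hφc.intervalIntegrable _ _) (Continuous.intervalIntegrable (by fun_prop) _ _), hrefl]
  ring

/-- `∫₀^{2π} f (s, r cos (θ - s)) ds`. -/
noncomputable def sectionIntegral (f : ℝ → ℝ → ℂ) (r θ : ℝ) : ℂ :=
  ∫ s in (0:ℝ)..(2 * π), f s (r * Real.cos (θ - s))

section Cylinder

variable {f : ℝ → ℝ → ℂ}

lemma RT_eq_zero_iff (θ ρ : ℝ) : RT f θ ρ = 0 ↔ sectionIntegral f (-Real.tan ρ) θ = 0 := by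
  simp [RT, sectionIntegral, Real.pi_ne_zero]

lemma continuous_sectionIntegral (hcont : Continuous (Function.uncurry f)) (r : ℝ) :
    Continuous (sectionIntegral f r) :=
  intervalIntegral.continuous_parametric_intervalIntegral_of_continuous'
    (f := fun θ s => f s (r * Real.cos (θ - s)))
    (hcont.comp (by fun_prop : Continuous fun p : ℝ × ℝ => (p.2, r * Real.cos (p.1 - p.2)))) _ _

lemma sectionIntegral_periodic (r : ℝ) : Function.Periodic (sectionIntegral f r) (2 * π) :=
  fun θ => by
    simp only [sectionIntegral, add_sub_right_comm, Real.cos_add_two_pi]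

lemma continuous_Fc (hcont : Continuous (Function.uncurry f)) (n : ℤ) : Continuous (Fc f n) := by
  have h1 : Continuous fun p : ℝ × ℝ => f p.2 p.1 := hcont.comp continuous_swap
  exact continuous_const.mul (intervalIntegral.continuous_parametric_intervalIntegral_of_continuous'
    (f := fun t s => f s t * Complex.exp (-Complex.I * n * s)) (h1.mul (by fun_prop)) _ _)

lemma integral_sectionIntegral_mul_exp (hcont : Continuous (Function.uncurry f)) (n : ℤ) (r : ℝ) :
    ∫ θ in (0:ℝ)..(2 * π), sectionIntegral f r θ * Complex.exp (-Complex.I * n * θ) =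
      2 * π * cosTransform n.natAbs (Fc f n) r := by
  have hf {α : Type} [TopologicalSpace α] {u v : α → ℝ} (hu : Continuous u) (hv : Continuous v) :
      Continuous fun x => f (u x) (v x) := hcont.comp (hu.prodMk hv)
  have hshift : ∀ s : ℝ, ∫ θ in (0:ℝ)..(2 * π),
      f s (r * Real.cos (θ - s)) * Complex.exp (-Complex.I * n * θ) =
      ∫ u in (0:ℝ)..(2 * π), f s (r * Real.cos u) * Complex.exp (-Complex.I * n * s) *
        Complex.exp (-Complex.I * n * u) := by
    intro s
    have hper : Function.Periodic (fun θ : ℝ => f s (r * Real.cos (θ - s)) *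
        Complex.exp (-Complex.I * n * θ)) (2 * π) := fun θ => by
      simp only [add_sub_right_comm, Real.cos_add_two_pi]
      rw [exp_neg_I_mul_int_mul_add_two_pi n θ]
    rw [← integral_shift_of_periodic hper s]
    congr 1
    ext u
    rw [add_sub_cancel_right, mul_assoc (f _ _), ← Complex.exp_add]
    push_cast
    ring_nf
  rw [← integral_mul_exp_eq_cosTransform n (continuous_Fc hcont n),
    ← intervalIntegral.integral_const_mul]
  simp only [sectionIntegral, ← intervalIntegral.integral_mul_const]
  rw [intervalIntegral_swap_of_continuous
    (g := fun θ s => f s (r * Real.cos (θ - s)) * Complex.exp (-Complex.I * n * θ))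
    ((hf (by fun_prop) (by fun_prop)).mul (by fun_prop))]
  simp only [hshift]
  rw [intervalIntegral_swap_of_continuous
    (g := fun s u => f s (r * Real.cos u) * Complex.exp (-Complex.I * n * s) *
        Complex.exp (-Complex.I * n * u))
    (((hf (by fun_prop) (by fun_prop)).mul (by fun_prop)).mul (by fun_prop))]
  congr 1
  ext u
  have : (π : ℂ) ≠ 0 := by exact_mod_cast Real.pi_ne_zero
  rw [intervalIntegral.integral_mul_const, Fc]
  field_simp

/-- The sections of `f` have vanishing integrals iff all cosine transforms of the Fourier
coefficients of `f` vanish. -/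
lemma sectionIntegral_eq_zero_iff (hcont : Continuous (Function.uncurry f)) (r : ℝ) :
    (∀ θ, sectionIntegral f r θ = 0) ↔ ∀ n : ℤ, cosTransform n.natAbs (Fc f n) r = 0 := by
  have hpi : (2 * π : ℂ) ≠ 0 := by exact_mod_cast Real.two_pi_pos.ne'
  constructor
  · intro h n
    have h1 := integral_sectionIntegral_mul_exp hcont n r
    simp only [h, zero_mul, intervalIntegral.integral_zero] at h1
    exact (mul_eq_zero.1 h1.symm).resolve_left hpi
  · intro h
    refine eq_zero_of_integral_exp_eq_zero (continuous_sectionIntegral hcont r)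
      (sectionIntegral_periodic r) fun n => ?_
    rw [integral_sectionIntegral_mul_exp hcont, h n, mul_zero]

lemma continuous_evenPart (hcont : Continuous (Function.uncurry f)) :
    Continuous (Function.uncurry (evenPart f)) := by
  have h1 : Continuous fun p : ℝ × ℝ => f (p.1 + π) (-p.2) :=
    hcont.comp (by fun_prop : Continuous fun p : ℝ × ℝ => (p.1 + π, -p.2))
  exact (hcont.add h1).div_const 2

lemma evenPart_add_pi (hper : ∀ s t : ℝ, f (s + 2 * π) t = f s t) (s t : ℝ) :
    evenPart f (s + π) (-t) = evenPart f s t := by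
  rw [evenPart, evenPart, neg_neg, add_assoc, ← two_mul, hper, add_comm]

lemma evenPart_periodic (hper : ∀ s t : ℝ, f (s + 2 * π) t = f s t) (s t : ℝ) :
    evenPart f (s + 2 * π) t = evenPart f s t := by
  rw [evenPart, evenPart, hper, add_right_comm, hper]

lemma sectionIntegral_evenPart (hcont : Continuous (Function.uncurry f))
    (hper : ∀ s t : ℝ, f (s + 2 * π) t = f s t) (r θ : ℝ) :
    sectionIntegral (evenPart f) r θ = sectionIntegral f r θ := by
  set ψ : ℝ → ℂ := fun s => f s (r * Real.cos (θ - s)) with hψ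
  have hψc : Continuous ψ :=
    hcont.comp (by fun_prop : Continuous fun s : ℝ => (s, r * Real.cos (θ - s)))
  have hψp : Function.Periodic ψ (2 * π) := fun s => by
    simp only [hψ]
    rw [hper, ← sub_sub, Real.cos_sub_two_pi]
  have : sectionIntegral (evenPart f) r θ = ∫ s in (0:ℝ)..(2 * π), (ψ s + ψ (s + π)) / 2 := by
    simp only [sectionIntegral, evenPart, hψ, ← sub_sub, Real.cos_sub_pi, mul_neg]
  rw [this, intervalIntegral.integral_div, intervalIntegral.integral_add
    (hψc.intervalIntegrable _ _) (Continuous.intervalIntegrable (by fun_prop) _ _),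
    integral_shift_of_periodic hψp, sectionIntegral]
  ring

lemma exp_neg_I_mul_int_mul_pi (n : ℤ) :
    Complex.exp (-Complex.I * n * π) = (-1) ^ n.natAbs := by
  rcases n.natAbs_eq with h | h
  · have hc : (n : ℂ) = n.natAbs := by
      simpa only [Int.cast_neg, Int.cast_natCast] using congrArg (Int.cast : ℤ → ℂ) h
    rw [hc, show -Complex.I * (n.natAbs : ℂ) * π = n.natAbs * (-(π * Complex.I)) by ring,
      Complex.exp_nat_mul, Complex.exp_neg, Complex.exp_pi_mul_I]
    simp
  · have hc : (n : ℂ) = -n.natAbs := by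
      simpa only [Int.cast_neg, Int.cast_natCast] using congrArg (Int.cast : ℤ → ℂ) h
    rw [hc, show -Complex.I * (-(n.natAbs : ℂ)) * π = n.natAbs * (π * Complex.I) by ring,
      Complex.exp_nat_mul, Complex.exp_pi_mul_I]

lemma Fc_evenPart_neg (hper : ∀ s t : ℝ, f (s + 2 * π) t = f s t) (n : ℤ) (t : ℝ) :
    Fc (evenPart f) n (-t) = (-1) ^ n.natAbs * Fc (evenPart f) n t := by
  have hp : Function.Periodic (fun s : ℝ => evenPart f s (-t) *
      Complex.exp (-Complex.I * n * s)) (2 * π) := fun s => by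
    simp only [evenPart_periodic hper]
    rw [exp_neg_I_mul_int_mul_add_two_pi n s]
  have hs : ∀ s : ℝ, Complex.exp (-Complex.I * n * (s + π : ℝ)) =
      Complex.exp (-Complex.I * n * s) * (-1) ^ n.natAbs := fun s => by
    rw [← exp_neg_I_mul_int_mul_pi, ← Complex.exp_add]
    push_cast
    ring_nf
  rw [Fc, Fc, ← integral_shift_of_periodic hp π]
  simp only [evenPart_add_pi hper, hs, ← mul_assoc]
  rw [intervalIntegral.integral_mul_const]
  ring

end Cylinder

/-- characterization of the null space of `R` on continuous functions. -/
theorem statement1 (f : ℝ → ℝ → ℂ)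
    (hcont : Continuous (Function.uncurry f))
    (hper : ∀ s t : ℝ, f (s + 2 * π) t = f s t) :
    (∀ θ : ℝ, ∀ ρ ∈ Set.Icc (0:ℝ) π, ρ ≠ π / 2 → RT f θ ρ = 0) ↔
      ((∀ n : ℤ, |n| ≤ 1 → ∀ t : ℝ, Fc (evenPart f) n t = 0) ∧
       (∀ n : ℤ, 2 ≤ |n| → ∃ a : ℕ → ℂ, ∀ t : ℝ,
          Fc (evenPart f) n t =
            ∑ m ∈ Finset.Icc 1 (n.natAbs / 2), a m * (t : ℂ) ^ (n.natAbs - 2 * m))) := by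
  have hE := continuous_evenPart hcont
  have key (r : ℝ) : (∀ θ, sectionIntegral f r θ = 0) ↔
      ∀ n : ℤ, cosTransform n.natAbs (Fc (evenPart f) n) r = 0 := by
    rw [← sectionIntegral_eq_zero_iff hE]
    simp only [sectionIntegral_evenPart hcont hper]
  simp only [RT_eq_zero_iff]
  constructor
  · intro h
    have hpoly (n : ℤ) := exists_polynomial_of_cosTransform_eq_zero n.natAbs (continuous_Fc hE n)
      (Fc_evenPart_neg hper n) fun r hr => (key r).1 (fun θ => by
        have h1 := h θ (π - Real.arctan r)
          ⟨by linarith [Real.arctan_lt_pi_div_two r, Real.pi_pos],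
            by linarith [Real.arctan_pos.2 hr]⟩
          (by linarith [Real.arctan_lt_pi_div_two r])
        rwa [Real.tan_pi_sub, Real.tan_arctan, neg_neg] at h1) n
    refine ⟨fun n hn t => ?_, fun n _ => hpoly n⟩
    obtain ⟨a, ha⟩ := hpoly n
    rw [Int.abs_eq_natAbs] at hn
    rw [ha, show n.natAbs / 2 = 0 by lia]
    simp
  · rintro ⟨h1, h2⟩ θ ρ - -
    refine (key _).2 (fun n => ?_) θ
    by_cases hn : |n| ≤ 1
    · simp [cosTransform, h1 n hn]
    · obtain ⟨a, ha⟩ := h2 n (by lia)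
      rw [Int.abs_eq_natAbs] at hn
      exact cosTransform_polynomial_eq_zero _ (by lia) ha _
end
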